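/- arXiv:2602.11922 — 2 statements merged into one kernel-verified Lean document; each statement's English description precedes it below -/
import Mathlib

section
/- Let p > 0 and let A and B be positive semidefinite n×n complex matrices. Then Tr(A κₚ B) ≤ √(Tr(A) · Tr(B)) ≤ Tr((A + B)/2). In particular, Tr((A + B)/2 − A κₚ B) ≥ 0 for all p > 0. -/
open scoped ComplexOrder

/-- Real power of a square complex matrix, taken via the continuous functional calculus
(on the spectrum, which lies in `[0, ∞)` for positive semidefinite matrices). -/
noncomputable def Matrix.rpowCFC {n : Type*} [Fintype n] [DecidableEq n]
    (A : Matrix n n ℂ) (r : ℝ) : Matrix n n ℂ :=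
  cfc (fun x : ℝ => x ^ r) A

/-- The operation `A κₚ B := (A^{p/4} B^{p/2} A^{p/4})^{1/p}`. -/
noncomputable def Matrix.kappa {n : Type*} [Fintype n] [DecidableEq n]
    (p : ℝ) (A B : Matrix n n ℂ) : Matrix n n ℂ :=
  (A.rpowCFC (p / 4) * B.rpowCFC (p / 2) * A.rpowCFC (p / 4)).rpowCFC p⁻¹

namespace Matrix

variable {n : Type*} [Fintype n] [DecidableEq n]

lemma continuousOn_spectrum_real (A : Matrix n n ℂ) (f : ℝ → ℝ) :
    ContinuousOn f (spectrum ℝ A) :=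
  A.finite_real_spectrum.continuousOn f

lemma PosSemidef.nonneg_of_mem_spectrum {A : Matrix n n ℂ} (hA : A.PosSemidef) {x : ℝ}
    (hx : x ∈ spectrum ℝ A) : 0 ≤ x := by
  obtain ⟨i, rfl⟩ := hA.1.spectrum_real_eq_range_eigenvalues ▸ hx
  exact hA.eigenvalues_nonneg i

lemma PosSemidef.cfc_congr_nonneg {A : Matrix n n ℂ} (hA : A.PosSemidef) {f g : ℝ → ℝ}
    (h : ∀ x, 0 ≤ x → f x = g x) : cfc f A = cfc g A :=
  cfc_congr fun _ hx => h _ (hA.nonneg_of_mem_spectrum hx)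

lemma cfc_mul_cfc (A : Matrix n n ℂ) (f g : ℝ → ℝ) :
    cfc f A * cfc g A = cfc (fun x => f x * g x) A :=
  (cfc_mul f g A (A.continuousOn_spectrum_real f) (A.continuousOn_spectrum_real g)).symm

lemma isHermitian_cfc (A : Matrix n n ℂ) (f : ℝ → ℝ) : (cfc f A).IsHermitian :=
  cfc_predicate f A

lemma IsHermitian.cfc_fun_id {A : Matrix n n ℂ} (hA : A.IsHermitian) :
    cfc (fun x : ℝ => x) A = A :=
  cfc_id' ℝ A hA

lemma IsHermitian.cfc_mul_self {A : Matrix n n ℂ} (hA : A.IsHermitian) (f : ℝ → ℝ) :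
    cfc f A * A = cfc (fun x => f x * x) A := by
  rw [← cfc_mul_cfc, hA.cfc_fun_id]

lemma IsHermitian.trace_cfc {A : Matrix n n ℂ} (hA : A.IsHermitian) (f : ℝ → ℝ) :
    (cfc f A).trace = ((∑ i, f (hA.eigenvalues i) : ℝ) : ℂ) := by
  rw [hA.cfc_eq, IsHermitian.cfc, Unitary.conjStarAlgAut_apply, trace_mul_cycle,
    Unitary.coe_star_mul_self, one_mul, trace_diagonal]
  simp

lemma IsHermitian.det_cfc {A : Matrix n n ℂ} (hA : A.IsHermitian) (f : ℝ → ℝ) :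
    (cfc f A).det = ((∏ i, f (hA.eigenvalues i) : ℝ) : ℂ) := by
  rw [hA.cfc_eq, IsHermitian.cfc, Unitary.conjStarAlgAut_apply, det_mul_comm, ← mul_assoc,
    Unitary.coe_star_mul_self, one_mul, det_diagonal]
  simp

lemma IsHermitian.trace_eq_sum_ofReal {A : Matrix n n ℂ} (hA : A.IsHermitian) :
    A.trace = ((∑ i, hA.eigenvalues i : ℝ) : ℂ) := by
  conv_lhs => rw [← hA.cfc_fun_id]
  exact hA.trace_cfc _

lemma mul_aeval_conjTranspose_mul_self (X : Matrix n n ℂ) (q : Polynomial ℝ) :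
    X * Polynomial.aeval (Xᴴ * X) q = Polynomial.aeval (X * Xᴴ) q * X := by
  induction q using Polynomial.induction_on with
  | C a => simpa using (Algebra.commutes a X).symm
  | add p q hp hq => simp [mul_add, add_mul, hp, hq]
  | monomial k a ih =>
    rw [pow_succ, ← mul_assoc, map_mul _ _ Polynomial.X, map_mul _ _ Polynomial.X, ← mul_assoc, ih,
      Polynomial.aeval_X, Polynomial.aeval_X]
    simp only [mul_assoc]

/-- The functional calculi of `Xᴴ * X` and `X * Xᴴ` are intertwined by `X`. -/
lemma mul_cfc_mul_conjTranspose (X : Matrix n n ℂ) (g : ℝ → ℝ) :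
    X * cfc g (Xᴴ * X) * Xᴴ = cfc (fun x => g x * x) (X * Xᴴ) := by
  have hM : IsSelfAdjoint (Xᴴ * X) := isHermitian_conjTranspose_mul_self X
  have hN : IsSelfAdjoint (X * Xᴴ) := isHermitian_mul_conjTranspose_self X
  let s : Finset ℝ :=
    (Xᴴ * X).finite_real_spectrum.toFinset ∪ (X * Xᴴ).finite_real_spectrum.toFinset
  let q : Polynomial ℝ := Lagrange.interpolate s id g
  have hq : ∀ x ∈ s, q.eval x = g x := fun x hx =>
    Lagrange.eval_interpolate_at_node g (Set.injOn_id _) hx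
  have hgM : cfc g (Xᴴ * X) = Polynomial.aeval (Xᴴ * X) q := by
    rw [← cfc_polynomial q _ hM]
    exact cfc_congr fun x hx => (hq x (by simp [s, hx])).symm
  have hgN : cfc g (X * Xᴴ) = Polynomial.aeval (X * Xᴴ) q := by
    rw [← cfc_polynomial q _ hN]
    exact cfc_congr fun x hx => (hq x (by simp [s, hx])).symm
  rw [hgM, mul_aeval_conjTranspose_mul_self, mul_assoc, ← hgN]
  exact IsHermitian.cfc_mul_self hN g

lemma IsHermitian.trace_cfc_mul_cfc {A T : Matrix n n ℂ} (hA : A.IsHermitian)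
    (hT : T.IsHermitian) :
    ∃ w : n → n → ℝ, (∀ i j, 0 ≤ w i j) ∧ (∀ i, ∑ j, w i j = 1) ∧ (∀ j, ∑ i, w i j = 1) ∧
      ∀ f g : ℝ → ℝ, (cfc f A * cfc g T).trace =
        ((∑ i, ∑ j, f (hA.eigenvalues i) * g (hT.eigenvalues j) * w i j : ℝ) : ℂ) := by
  let W : unitaryGroup n ℂ := star hA.eigenvectorUnitary * hT.eigenvectorUnitary
  refine ⟨fun i j => Complex.normSq ((W : Matrix n n ℂ) i j), fun i j => Complex.normSq_nonneg _,
    fun i => ?_, fun j => ?_, fun f g => ?_⟩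
  · have h := congr_fun₂ (Unitary.coe_mul_star_self W) i i
    rw [mul_apply, one_apply_eq] at h
    simp only [Unitary.coe_star, star_apply, RCLike.star_def, Complex.mul_conj] at h
    exact_mod_cast h
  · have h := congr_fun₂ (Unitary.coe_star_mul_self W) j j
    rw [mul_apply, one_apply_eq] at h
    simp only [star_apply, RCLike.star_def,
      mul_comm ((starRingEnd ℂ) _), Complex.mul_conj] at h
    exact_mod_cast h
  · rw [hA.cfc_eq, hT.cfc_eq, IsHermitian.cfc, IsHermitian.cfc, Unitary.conjStarAlgAut_apply,
      Unitary.conjStarAlgAut_apply]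
    have hW : (W : Matrix n n ℂ) =
      star (hA.eigenvectorUnitary : Matrix n n ℂ) * (hT.eigenvectorUnitary : Matrix n n ℂ) := rfl
    have hW' : star (W : Matrix n n ℂ) =
      star (hT.eigenvectorUnitary : Matrix n n ℂ) * (hA.eigenvectorUnitary : Matrix n n ℂ) := by
      rw [hW, star_mul, star_star]
    rw [mul_assoc (hA.eigenvectorUnitary : Matrix n n ℂ), mul_assoc (hA.eigenvectorUnitary :
      Matrix n n ℂ), trace_mul_comm, ← mul_assoc, ← mul_assoc, mul_assoc (_ * _ * _) (star _) _,
      mul_assoc (diagonal _) (star _) _, ← hW, mul_assoc _ _ (star _ * _), ← hW']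
    rw [trace, Complex.ofReal_sum]
    refine Finset.sum_congr rfl fun i _ => ?_
    rw [diag_apply, mul_apply, Complex.ofReal_sum]
    refine Finset.sum_congr rfl fun j _ => ?_
    rw [diagonal_mul, diagonal_mul, star_apply, Complex.ofReal_mul, ← Complex.mul_conj]
    simp only [Function.comp_apply, RCLike.star_def, Complex.coe_algebraMap, Complex.ofReal_mul]
    ring

/-- A scalar inequality `f x * g y ≤ φ x + ψ y` lifts to traces of functions of two matrices. -/
lemma PosSemidef.re_trace_cfc_mul_cfc_le {A T : Matrix n n ℂ} (hA : A.PosSemidef)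
    (hT : T.PosSemidef) {f g φ ψ : ℝ → ℝ}
    (h : ∀ x y, 0 ≤ x → 0 ≤ y → f x * g y ≤ φ x + ψ y) :
    (cfc f A * cfc g T).trace.re ≤ (cfc φ A).trace.re + (cfc ψ T).trace.re := by
  obtain ⟨w, hw, hrow, hcol, htr⟩ := hA.1.trace_cfc_mul_cfc hT.1
  rw [htr, hA.1.trace_cfc, hT.1.trace_cfc, Complex.ofReal_re, Complex.ofReal_re, Complex.ofReal_re]
  have h1 : ∑ i, φ (hA.1.eigenvalues i) = ∑ i, ∑ j, φ (hA.1.eigenvalues i) * w i j := by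
    simp_rw [← Finset.mul_sum, hrow, mul_one]
  have h2 : ∑ j, ψ (hT.1.eigenvalues j) = ∑ i, ∑ j, ψ (hT.1.eigenvalues j) * w i j := by
    rw [Finset.sum_comm]
    simp_rw [← Finset.mul_sum, hcol, mul_one]
  rw [h1, h2, ← Finset.sum_add_distrib]
  refine Finset.sum_le_sum fun i _ => ?_
  rw [← Finset.sum_add_distrib]
  refine Finset.sum_le_sum fun j _ => ?_
  rw [← add_mul]
  exact mul_le_mul_of_nonneg_right
    (h _ _ (hA.eigenvalues_nonneg i) (hT.eigenvalues_nonneg j)) (hw i j)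

lemma two_mul_re_trace_mul_le {m : Type*} [Fintype m] (K L : Matrix m m ℂ) :
    2 * (K * L).trace.re ≤ (K * Kᴴ).trace.re + (Lᴴ * L).trace.re := by
  have h := (posSemidef_conjTranspose_mul_self (Kᴴ - L)).trace_nonneg
  have h0 := (Complex.le_def.1 h).1
  have h1 : (Lᴴ * Kᴴ).trace.re = (K * L).trace.re := by
    rw [← conjTranspose_mul, trace_conjTranspose]; simp
  simp only [conjTranspose_sub, conjTranspose_conjTranspose, sub_mul, mul_sub, trace_sub,
    Complex.sub_re, h1, Complex.zero_re] at h0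
  linarith

lemma PosSemidef.rpowCFC_add {A : Matrix n n ℂ} (hA : A.PosSemidef) {r s : ℝ} (hr : 0 < r)
    (hs : 0 < s) : A.rpowCFC r * A.rpowCFC s = A.rpowCFC (r + s) := by
  rw [rpowCFC, rpowCFC, cfc_mul_cfc]
  exact hA.cfc_congr_nonneg fun x hx => (Real.rpow_add_of_nonneg hx hr.le hs.le).symm

lemma PosSemidef.rpowCFC_sq {A : Matrix n n ℂ} (hA : A.PosSemidef) {p : ℝ} (hp : 0 < p) :
    A.rpowCFC (p / 4) * A.rpowCFC (p / 4) = A.rpowCFC (p / 2) := by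
  rw [hA.rpowCFC_add (by positivity) (by positivity)]
  congr 1
  ring

lemma PosSemidef.kappa_eq {A B : Matrix n n ℂ} (hB : B.PosSemidef) {p : ℝ} (hp : 0 < p) :
    kappa p A B = ((B.rpowCFC (p / 4) * A.rpowCFC (p / 4))ᴴ *
      (B.rpowCFC (p / 4) * A.rpowCFC (p / 4))).rpowCFC p⁻¹ := by
  have hY : (B.rpowCFC (p / 4))ᴴ = B.rpowCFC (p / 4) := isHermitian_cfc B _
  have hZ : (A.rpowCFC (p / 4))ᴴ = A.rpowCFC (p / 4) := isHermitian_cfc A _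
  rw [kappa, conjTranspose_mul, hY, hZ, ← hB.rpowCFC_sq hp]
  simp only [mul_assoc]

lemma IsHermitian.trace_cfc_const_mul {A : Matrix n n ℂ} (hA : A.IsHermitian) (c : ℝ)
    (f : ℝ → ℝ) : (cfc (fun x => c * f x) A).trace.re = c * (cfc f A).trace.re := by
  rw [hA.trace_cfc, hA.trace_cfc, Complex.ofReal_re, Complex.ofReal_re, Finset.mul_sum]

lemma PosSemidef.re_trace_rpowCFC_mul_cfc_le {A T : Matrix n n ℂ} (hA : A.PosSemidef)
    (hT : T.PosSemidef) {p : ℝ} (hp : 0 < p) (hp1 : p ≤ 1) {g : ℝ → ℝ}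
    (hg : ∀ y, 0 ≤ y → g y = y ^ (p⁻¹ - 1 / 2)) :
    (A.rpowCFC (p / 2) * cfc g T).trace.re ≤
      p / 2 * A.trace.re + (1 - p / 2) * (T.rpowCFC p⁻¹).trace.re := by
  have h := hA.re_trace_cfc_mul_cfc_le hT (f := fun x => x ^ (p / 2)) (g := g)
    (φ := fun x => p / 2 * x) (ψ := fun y => (1 - p / 2) * y ^ p⁻¹) fun x y hx hy => by
      have hy' : (y ^ p⁻¹) ^ (1 - p / 2) = y ^ (p⁻¹ - 1 / 2) := by
        rw [← Real.rpow_mul hy]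
        congr 1
        field_simp
      have := Real.geom_mean_le_arith_mean2_weighted (w₁ := p / 2) (w₂ := 1 - p / 2)
        (by positivity) (by linarith) hx (Real.rpow_nonneg hy p⁻¹) (by ring)
      rw [hg y hy]
      rwa [hy'] at this
  rw [hA.1.trace_cfc_const_mul, hT.1.trace_cfc_const_mul, hA.1.cfc_fun_id] at h
  exact h

lemma PosSemidef.re_trace_kappa_le_of_le_one {A B : Matrix n n ℂ} (hA : A.PosSemidef)
    (hB : B.PosSemidef) {p : ℝ} (hp : 0 < p) (hp1 : p ≤ 1) :
    (kappa p A B).trace.re ≤ (A.trace.re + B.trace.re) / 2 := by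
  rw [hB.kappa_eq hp]
  have hY : (B.rpowCFC (p / 4))ᴴ = B.rpowCFC (p / 4) := isHermitian_cfc B _
  have hZ : (A.rpowCFC (p / 4))ᴴ = A.rpowCFC (p / 4) := isHermitian_cfc A _
  have hYY := hB.rpowCFC_sq hp
  have hZZ := hA.rpowCFC_sq hp
  set Y := B.rpowCFC (p / 4)
  set Z := A.rpowCFC (p / 4)
  set X := Y * Z with hX
  have hM : (Xᴴ * X).PosSemidef := posSemidef_conjTranspose_mul_self X
  have hN : (X * Xᴴ).PosSemidef := posSemidef_self_mul_conjTranspose X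
  have hp_inv : 1 ≤ p⁻¹ := (one_le_inv₀ hp).2 hp1
  set s : ℝ := (p⁻¹ - 3 / 2) / 2 with hs
  set t : ℝ := (p⁻¹ - 1 / 2) / 2 with ht
  set P := cfc (fun x : ℝ => x ^ s) (Xᴴ * X) with hP
  set Q := cfc (fun x : ℝ => x ^ t) (Xᴴ * X) with hQ
  have hPh : Pᴴ = P := isHermitian_cfc _ _
  have hQh : Qᴴ = Q := isHermitian_cfc _ _
  have hτ : (Xᴴ * X).rpowCFC p⁻¹ = P * (Xᴴ * X) * Q := by
    rw [hP, hQ, hM.1.cfc_mul_self, cfc_mul_cfc]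
    refine hM.cfc_congr_nonneg fun x hx => ?_
    rcases hx.eq_or_lt with rfl | hx
    · rw [Real.zero_rpow (by positivity)]; simp
    · rw [← Real.rpow_add_one hx.ne', ← Real.rpow_add hx]
      congr 1
      rw [hs, ht]; ring
  have hτN : ((X * Xᴴ).rpowCFC p⁻¹).trace = ((Xᴴ * X).rpowCFC p⁻¹).trace := by
    have h1 : (X * Xᴴ).rpowCFC p⁻¹ = X * cfc (fun x : ℝ => x ^ (p⁻¹ - 1)) (Xᴴ * X) * Xᴴ := by
      rw [mul_cfc_mul_conjTranspose]
      refine hN.cfc_congr_nonneg fun x hx => ?_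
      rcases hx.eq_or_lt with rfl | hx
      · rw [Real.zero_rpow (by positivity)]; simp
      · rw [← Real.rpow_add_one hx.ne']; simp
    have h2 : (Xᴴ * X).rpowCFC p⁻¹ = cfc (fun x : ℝ => x ^ (p⁻¹ - 1)) (Xᴴ * X) * (Xᴴ * X) := by
      rw [hM.1.cfc_mul_self]
      refine hM.cfc_congr_nonneg fun x hx => ?_
      rcases hx.eq_or_lt with rfl | hx
      · rw [Real.zero_rpow (by positivity)]; simp
      · rw [← Real.rpow_add_one hx.ne']; simp
    rw [h1, h2, mul_assoc, trace_mul_comm, mul_assoc]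
  have hcs := two_mul_re_trace_mul_le (P * Xᴴ * Y) (Z * Q)
  have e1 : (P * Xᴴ * Y * (Z * Q)).trace = ((Xᴴ * X).rpowCFC p⁻¹).trace := by
    rw [hτ, hX]; simp only [mul_assoc]
  have e2 : (P * Xᴴ * Y * (P * Xᴴ * Y)ᴴ).trace =
      (B.rpowCFC (p / 2) * cfc (fun x : ℝ => x ^ s * x ^ s * x) (X * Xᴴ)).trace := by
    rw [← mul_cfc_mul_conjTranspose X (fun x : ℝ => x ^ s * x ^ s), ← cfc_mul_cfc, ← hP, ← hYY]
    simp only [conjTranspose_mul, conjTranspose_conjTranspose, hPh, hY]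
    rw [mul_assoc (P * Xᴴ), trace_mul_comm]
    simp only [mul_assoc]
  have e3 : ((Z * Q)ᴴ * (Z * Q)).trace =
      (A.rpowCFC (p / 2) * cfc (fun x : ℝ => x ^ t * x ^ t) (Xᴴ * X)).trace := by
    rw [← cfc_mul_cfc, ← hQ, ← hZZ, conjTranspose_mul, hQh, hZ, mul_assoc, trace_mul_comm Q]
    simp only [mul_assoc]
  have i2 := hB.re_trace_rpowCFC_mul_cfc_le hN hp hp1 (g := fun x => x ^ s * x ^ s * x)
    fun y hy => by
      rcases hy.eq_or_lt with rfl | hy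
      · rw [Real.zero_rpow (by linarith : (0 : ℝ) < p⁻¹ - 1 / 2).ne', mul_zero]
      · rw [← Real.rpow_add hy, ← Real.rpow_add_one hy.ne']
        congr 1
        rw [hs]; ring
  have i3 := hA.re_trace_rpowCFC_mul_cfc_le hM hp hp1 (g := fun x => x ^ t * x ^ t)
    fun y hy => by
      rw [← Real.rpow_add_of_nonneg hy (by linarith) (by linarith)]
      congr 1
      rw [ht]; ring
  rw [e1, e2, e3] at hcs
  rw [hτN] at i2
  set τ := ((Xᴴ * X).rpowCFC p⁻¹).trace.re
  nlinarith

lemma IsHermitian.det_one_add_cfc {A : Matrix n n ℂ} (hA : A.IsHermitian) (f : ℝ → ℝ) :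
    (1 + cfc f A).det = ((∏ i, (1 + f (hA.eigenvalues i)) : ℝ) : ℂ) := by
  rw [← hA.det_cfc fun x => 1 + f x, cfc_const_add 1 f A
    (A.continuousOn_spectrum_real f) hA.isSelfAdjoint, map_one]

lemma PosSemidef.one_le_det_one_add {A : Matrix n n ℂ} (hA : A.PosSemidef) :
    1 ≤ (1 + A).det := by
  have h := hA.1.det_one_add_cfc fun x => x
  rw [hA.1.cfc_fun_id] at h
  rw [h]
  exact_mod_cast Finset.prod_induction _ (fun x : ℝ => 1 ≤ x)
    (fun _ _ => one_le_mul_of_one_le_of_one_le) le_rfl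
    fun i _ => by linarith [hA.eigenvalues_nonneg i]

open scoped MatrixOrder in
lemma PosSemidef.det_le_det {S T : Matrix n n ℂ} (hS : S.PosSemidef) (h : (T - S).PosSemidef) :
    S.det ≤ T.det := by
  have hT : T.PosSemidef := by simpa using hS.add h
  by_cases h0 : S.det = 0
  · rw [h0]; exact hT.det_nonneg
  have hSd : S.PosDef := hS.posDef_iff_det_ne_zero.2 h0
  obtain ⟨R, hR⟩ := CStarAlgebra.nonneg_iff_eq_star_mul_self.mp h.nonneg
  have hu : IsUnit S.det := isUnit_iff_ne_zero.2 h0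
  have hT' : T = S * (1 + S⁻¹ * Rᴴ * R) := by
    rw [mul_add, mul_one, mul_assoc, ← mul_assoc S, mul_nonsing_inv _ hu, one_mul]
    exact eq_add_of_sub_eq' hR
  rw [hT', det_mul, det_one_add_mul_comm, ← mul_assoc]
  exact le_mul_of_one_le_right hS.det_nonneg
    (hSd.inv.posSemidef.mul_mul_conjTranspose_same R).one_le_det_one_add

/-- Cauchy–Schwarz inequality for determinants. -/
lemma IsHermitian.det_one_add_mul_le {Y Z : Matrix n n ℂ} (hY : Y.IsHermitian)
    (hZ : Z.IsHermitian) :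
    (1 + Y * Z).det * (1 + Z * Y).det ≤ (1 + Y * Y).det * (1 + Z * Z).det := by
  have hD : (1 + Z * Z).PosDef := by
    have h := posSemidef_conjTranspose_mul_self Z
    rw [hZ.eq] at h
    exact PosDef.one.add_posSemidef h
  set G := (1 + Z * Z)⁻¹ with hG
  have hu : IsUnit (1 + Z * Z).det := hD.det_pos.ne'.isUnit
  have h1 : (1 + Z * Z) * G = 1 := mul_nonsing_inv _ hu
  have h2 : G * (1 + Z * Z) = 1 := nonsing_inv_mul _ hu
  have hZG : Z * G = G * Z := by
    calc Z * G = G * (1 + Z * Z) * Z * G := by rw [h2, one_mul]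
      _ = G * Z * ((1 + Z * Z) * G) := by noncomm_ring
      _ = G * Z := by rw [h1, mul_one]
  have hZGZ : Z * G * Z = 1 - G := by
    rw [eq_sub_iff_add_eq, hZG, ← h2]; noncomm_ring
  have hGp : G.PosSemidef := hD.inv.posSemidef
  have hC : (1 + Y * Z)ᴴ = 1 + Z * Y := by
    rw [conjTranspose_add, conjTranspose_mul, hY.eq, hZ.eq, conjTranspose_one]
  have hS : ((1 + Y * Z) * G * (1 + Z * Y)).PosSemidef := by
    rw [← hC]; exact hGp.mul_mul_conjTranspose_same _
  have hE : (1 + Y * Y - (1 + Y * Z) * G * (1 + Z * Y)).PosSemidef := by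
    have : 1 + Y * Y - (1 + Y * Z) * G * (1 + Z * Y) = (Y - Z) * G * (Y - Z)ᴴ := by
      have e1 : (1 + Y * Z) * G * (1 + Z * Y) =
          G + Y * (Z * G) + G * Z * Y + Y * (Z * G * Z) * Y := by noncomm_ring
      have e2 : (Y - Z) * G * (Y - Z) = Y * G * Y - Y * (G * Z) - Z * G * Y + Z * G * Z := by
        noncomm_ring
      rw [conjTranspose_sub, hY.eq, hZ.eq, e1, e2, hZGZ, hZG]
      noncomm_ring
    rw [this]
    exact hGp.mul_mul_conjTranspose_same _
  have h := hS.det_le_det hE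
  rw [det_mul, det_mul] at h
  have hdet : (1 + Z * Z).det * G.det = 1 := by rw [← det_mul, h1, det_one]
  calc (1 + Y * Z).det * (1 + Z * Y).det
      = (1 + Y * Z).det * G.det * (1 + Z * Y).det * (1 + Z * Z).det := by
        linear_combination (-((1 + Y * Z).det * (1 + Z * Y).det)) * hdet
    _ ≤ _ := mul_le_mul_of_nonneg_right h hD.det_pos.le

lemma PosSemidef.det_one_add_smul_sq_le {A B : Matrix n n ℂ} (hA : A.PosSemidef)
    (hB : B.PosSemidef) {p t : ℝ} (hp : 0 < p) (ht : 0 ≤ t)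
    (hM : ((B.rpowCFC (p / 4) * A.rpowCFC (p / 4))ᴴ *
      (B.rpowCFC (p / 4) * A.rpowCFC (p / 4))).PosSemidef) :
    (∏ i, (1 + t * hM.1.eigenvalues i)) ^ 2 ≤
      (∏ i, (1 + t * hB.1.eigenvalues i ^ p)) * ∏ i, (1 + t * hA.1.eigenvalues i ^ p) := by
  have key : ∀ {T : Matrix n n ℂ} (hT : T.PosSemidef),
      cfc (fun x => √t * x ^ (p / 2)) T * cfc (fun x => √t * x ^ (p / 2)) T =
        cfc (fun x : ℝ => t * x ^ p) T := fun {T} hT => by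
    rw [cfc_mul_cfc]
    refine hT.cfc_congr_nonneg fun x hx => ?_
    rw [mul_mul_mul_comm, Real.mul_self_sqrt ht,
      ← Real.rpow_add_of_nonneg hx (by positivity) (by positivity), add_halves]
  have hs : ∀ T : Matrix n n ℂ, cfc (fun x => √t * x ^ (p / 2)) T = √t • T.rpowCFC (p / 2) :=
    fun T => cfc_const_mul _ _ T (T.continuousOn_spectrum_real _)
  have h := (isHermitian_cfc B fun x => √t * x ^ (p / 2)).det_one_add_mul_le
    (isHermitian_cfc A fun x => √t * x ^ (p / 2))
  rw [key hA, key hB, det_one_add_mul_comm, ← sq, hB.1.det_one_add_cfc,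
    hA.1.det_one_add_cfc] at h
  have hdet : (1 + cfc (fun x => √t * x ^ (p / 2)) A * cfc (fun x => √t * x ^ (p / 2)) B).det =
      ((∏ i, (1 + t * hM.1.eigenvalues i) : ℝ) : ℂ) := by
    rw [← hM.1.det_one_add_cfc fun x => t * x, cfc_const_mul_id t _ hM.1.isSelfAdjoint,
      hs, hs, smul_mul_smul_comm, Real.mul_self_sqrt ht]
    have hY : (B.rpowCFC (p / 4))ᴴ = B.rpowCFC (p / 4) := isHermitian_cfc B _
    have hZ : (A.rpowCFC (p / 4))ᴴ = A.rpowCFC (p / 4) := isHermitian_cfc A _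
    have e : t • (A.rpowCFC (p / 4) * B.rpowCFC (p / 4) *
        (B.rpowCFC (p / 4) * A.rpowCFC (p / 4))) =
        t • (A.rpowCFC (p / 4) * B.rpowCFC (p / 4) * B.rpowCFC (p / 4)) * A.rpowCFC (p / 4) := by
      rw [smul_mul_assoc]; simp only [mul_assoc]
    rw [conjTranspose_mul, hY, hZ, e, det_one_add_mul_comm (t • _) (A.rpowCFC (p / 4)),
      mul_smul_comm, ← hA.rpowCFC_sq hp, ← hB.rpowCFC_sq hp]
    simp only [mul_assoc]
  rw [hdet] at h
  exact_mod_cast h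

end Matrix

open MeasureTheory Set in
lemma integrableOn_log_one_add_mul_rpow {α : ℝ} (h0 : 0 < α) (h1 : α < 1) :
    IntegrableOn (fun u : ℝ => Real.log (1 + u) * u ^ (-α - 1)) (Ioi 0) := by
  have hmeas : Measurable fun u : ℝ => Real.log (1 + u) * u ^ (-α - 1) := by fun_prop
  rw [← Ioc_union_Ioi_eq_Ioi zero_le_one]
  refine IntegrableOn.union ?_ ?_
  · have hg : IntegrableOn (fun u : ℝ => u ^ (-α)) (Ioc 0 1) := by
      rw [← intervalIntegrable_iff_integrableOn_Ioc_of_le zero_le_one]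
      exact intervalIntegral.intervalIntegrable_rpow' (by linarith)
    refine Integrable.mono' hg hmeas.aestronglyMeasurable ?_
    refine (ae_restrict_iff' measurableSet_Ioc).2 (ae_of_all _ fun u hu => ?_)
    have hlog : 0 ≤ Real.log (1 + u) := Real.log_nonneg (by linarith [hu.1])
    rw [Real.norm_of_nonneg (mul_nonneg hlog (Real.rpow_nonneg hu.1.le _))]
    calc Real.log (1 + u) * u ^ (-α - 1) ≤ u * u ^ (-α - 1) := by
          have := hu.1
          gcongr
          have := Real.log_le_sub_one_of_pos (show 0 < 1 + u by linarith [hu.1])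
          linarith
      _ = u ^ (-α) := by
          rw [mul_comm, ← Real.rpow_add_one hu.1.ne', sub_add_cancel]
  · have hg : IntegrableOn (fun u : ℝ => 2 ^ (α / 2) / (α / 2) * u ^ (-(α / 2) - 1)) (Ioi 1) :=
      (integrableOn_Ioi_rpow_of_lt (by linarith) one_pos).const_mul _
    refine Integrable.mono' hg hmeas.aestronglyMeasurable ?_
    refine (ae_restrict_iff' measurableSet_Ioi).2 (ae_of_all _ fun u (hu : 1 < u) => ?_)
    have hu0 : 0 < u := by linarith
    have hlog : 0 ≤ Real.log (1 + u) := Real.log_nonneg (by linarith)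
    rw [Real.norm_of_nonneg (mul_nonneg hlog (Real.rpow_nonneg hu0.le _))]
    have hle : Real.log (1 + u) ≤ 2 ^ (α / 2) / (α / 2) * u ^ (α / 2) := by
      calc Real.log (1 + u) ≤ (1 + u) ^ (α / 2) / (α / 2) :=
            Real.log_le_rpow_div (by linarith) (by linarith)
        _ ≤ (2 * u) ^ (α / 2) / (α / 2) := by gcongr; linarith
        _ = _ := by rw [Real.mul_rpow two_pos.le hu0.le]; ring
    calc Real.log (1 + u) * u ^ (-α - 1)
        ≤ 2 ^ (α / 2) / (α / 2) * u ^ (α / 2) * u ^ (-α - 1) := by gcongr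
      _ = _ := by rw [mul_assoc, ← Real.rpow_add hu0]; congr 2; ring

open MeasureTheory Set in
/-- For `0 < α < 1`, `x ^ α` is a positive superposition of the functions `log (1 + t * x)`. -/
lemma exists_integral_log_one_add_mul {α : ℝ} (h0 : 0 < α) (h1 : α < 1) :
    ∃ C : ℝ, 0 < C ∧ ∀ x : ℝ, 0 ≤ x →
      IntegrableOn (fun t : ℝ => Real.log (1 + t * x) * t ^ (-α - 1)) (Ioi 0) ∧
      ∫ t in Ioi (0 : ℝ), Real.log (1 + t * x) * t ^ (-α - 1) = C * x ^ α := by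
  have hint := integrableOn_log_one_add_mul_rpow h0 h1
  refine ⟨∫ u in Ioi (0 : ℝ), Real.log (1 + u) * u ^ (-α - 1), ?_, fun x hx => ?_⟩
  · have hpos : ∀ u ∈ Ioi (0 : ℝ), 0 < Real.log (1 + u) * u ^ (-α - 1) := fun u hu =>
      mul_pos (Real.log_pos (by linarith [mem_Ioi.1 hu])) (Real.rpow_pos_of_pos hu _)
    rw [setIntegral_pos_iff_support_of_nonneg_ae
      ((ae_restrict_iff' measurableSet_Ioi).2 (ae_of_all _ fun u hu => (hpos u hu).le)) hint]
    have : Ioi (0 : ℝ) ⊆ (Function.support fun u : ℝ => Real.log (1 + u) * u ^ (-α - 1)) ∩ Ioi 0 :=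
      fun u hu => ⟨(hpos u hu).ne', hu⟩
    exact lt_of_lt_of_le (by simp) (measure_mono this)
  · rcases hx.eq_or_lt with rfl | hx
    · simp [Real.zero_rpow h0.ne']
    have heq : EqOn (fun t : ℝ => Real.log (1 + t * x) * t ^ (-α - 1))
        (fun t => x ^ (α + 1) * (Real.log (1 + x * t) * (x * t) ^ (-α - 1))) (Ioi 0) := by
      intro t ht
      have : x ^ (α + 1) * x ^ (-α - 1) = 1 := by
        rw [← Real.rpow_add hx]; simp
      simp only
      rw [Real.mul_rpow hx.le (mem_Ioi.1 ht).le, mul_comm x t]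
      linear_combination (-(Real.log (1 + t * x) * t ^ (-α - 1))) * this
    constructor
    · rw [integrableOn_congr_fun heq measurableSet_Ioi]
      refine Integrable.const_mul ?_ _
      have := (integrableOn_Ioi_comp_mul_left_iff
        (fun u : ℝ => Real.log (1 + u) * u ^ (-α - 1)) 0 hx).2 (by simpa using hint)
      exact this
    · rw [setIntegral_congr_fun measurableSet_Ioi heq, integral_const_mul,
        integral_comp_mul_left_Ioi (fun u : ℝ => Real.log (1 + u) * u ^ (-α - 1)) 0 hx, mul_zero,
        smul_eq_mul, Real.rpow_add_one hx.ne']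
      field_simp

open MeasureTheory Set in
/-- Inequalities between products `∏ (1 + t * xᵢ)` pass to sums of powers `∑ xᵢ ^ α`. -/
lemma two_mul_sum_rpow_le_of_prod_sq_le {ι : Type*} [Fintype ι] {x y z : ι → ℝ}
    (hx : ∀ i, 0 ≤ x i) (hy : ∀ i, 0 ≤ y i) (hz : ∀ i, 0 ≤ z i)
    (h : ∀ t, 0 < t → (∏ i, (1 + t * x i)) ^ 2 ≤ (∏ i, (1 + t * y i)) * ∏ i, (1 + t * z i))
    {α : ℝ} (h0 : 0 < α) (h1 : α < 1) :
    2 * ∑ i, x i ^ α ≤ ∑ i, y i ^ α + ∑ i, z i ^ α := by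
  obtain ⟨C, hC, hint⟩ := exists_integral_log_one_add_mul h0 h1
  have hI : ∀ {w : ι → ℝ}, (∀ i, 0 ≤ w i) →
      IntegrableOn (fun t : ℝ => ∑ i, Real.log (1 + t * w i) * t ^ (-α - 1)) (Ioi 0) ∧
      ∫ t in Ioi (0 : ℝ), ∑ i, Real.log (1 + t * w i) * t ^ (-α - 1) = C * ∑ i, w i ^ α :=
    fun {w} hw => by
      refine ⟨integrable_finsetSum _ fun i _ => (hint (w i) (hw i)).1, ?_⟩
      rw [integral_finsetSum _ fun i _ => (hint (w i) (hw i)).1, Finset.mul_sum]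
      exact Finset.sum_congr rfl fun i _ => (hint (w i) (hw i)).2
  have hlog : ∀ {w : ι → ℝ}, (∀ i, 0 ≤ w i) → ∀ t, 0 < t →
      Real.log (∏ i, (1 + t * w i)) = ∑ i, Real.log (1 + t * w i) := fun {w} hw t ht =>
    Real.log_prod fun i _ => by have := mul_nonneg ht.le (hw i); positivity
  have hpos : ∀ {w : ι → ℝ}, (∀ i, 0 ≤ w i) → ∀ t, 0 < t → 0 < ∏ i, (1 + t * w i) :=
    fun {w} hw t ht => Finset.prod_pos fun i _ => by
      have := mul_nonneg ht.le (hw i); positivity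
  have hmono := setIntegral_mono_on ((hI hx).1.const_mul 2) ((hI hy).1.add (hI hz).1)
    measurableSet_Ioi fun t (ht : 0 < t) => by
      have hl := Real.log_le_log (pow_pos (hpos hx t ht) 2) (h t ht)
      rw [Real.log_pow, Real.log_mul (hpos hy t ht).ne' (hpos hz t ht).ne', hlog hx t ht,
        hlog hy t ht, hlog hz t ht] at hl
      have := mul_le_mul_of_nonneg_right hl (Real.rpow_nonneg ht.le (-α - 1))
      simp only [Pi.add_apply, ← Finset.sum_mul]
      push_cast at this
      linarith
  rw [integral_const_mul, (hI hx).2] at hmono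
  simp only [Pi.add_apply] at hmono
  rw [integral_add (hI hy).1 (hI hz).1, (hI hy).2, (hI hz).2] at hmono
  refine le_of_mul_le_mul_left ?_ hC
  linarith

namespace Matrix

variable {n : Type*} [Fintype n] [DecidableEq n]

lemma PosSemidef.re_trace_kappa_le_of_one_lt {A B : Matrix n n ℂ} (hA : A.PosSemidef)
    (hB : B.PosSemidef) {p : ℝ} (hp : 1 < p) :
    (kappa p A B).trace.re ≤ (A.trace.re + B.trace.re) / 2 := by
  have hp0 : 0 < p := by linarith
  have hM := posSemidef_conjTranspose_mul_self (B.rpowCFC (p / 4) * A.rpowCFC (p / 4))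
  have h := two_mul_sum_rpow_le_of_prod_sq_le (α := p⁻¹) hM.eigenvalues_nonneg
    (fun i => Real.rpow_nonneg (hB.eigenvalues_nonneg i) p)
    (fun i => Real.rpow_nonneg (hA.eigenvalues_nonneg i) p)
    (fun t ht => hA.det_one_add_smul_sq_le hB hp0 ht.le hM) (by positivity)
    (inv_lt_one_of_one_lt₀ hp)
  simp only [Real.rpow_rpow_inv (hA.eigenvalues_nonneg _) hp0.ne',
    Real.rpow_rpow_inv (hB.eigenvalues_nonneg _) hp0.ne'] at h
  rw [hB.kappa_eq hp0, rpowCFC, hM.1.trace_cfc, hA.1.trace_eq_sum_ofReal,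
    hB.1.trace_eq_sum_ofReal, Complex.ofReal_re, Complex.ofReal_re, Complex.ofReal_re]
  linarith

lemma PosSemidef.re_trace_kappa_le {A B : Matrix n n ℂ} (hA : A.PosSemidef)
    (hB : B.PosSemidef) {p : ℝ} (hp : 0 < p) :
    (kappa p A B).trace.re ≤ (A.trace.re + B.trace.re) / 2 :=
  (le_or_gt p 1).elim (hA.re_trace_kappa_le_of_le_one hB hp) (hA.re_trace_kappa_le_of_one_lt hB)

lemma PosSemidef.rpowCFC_smul {A : Matrix n n ℂ} (hA : A.PosSemidef) {c : ℝ} (hc : 0 ≤ c)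
    (r : ℝ) : (c • A).rpowCFC r = c ^ r • A.rpowCFC r := by
  have hfin : ContinuousOn (fun x : ℝ => x ^ r) ((c • ·) '' spectrum ℝ A) :=
    (A.finite_real_spectrum.image _).continuousOn _
  rw [rpowCFC, rpowCFC, ← cfc_comp_smul c (fun x : ℝ => x ^ r) A hfin hA.1.isSelfAdjoint,
    ← cfc_smul (c ^ r) _ A (A.continuousOn_spectrum_real _)]
  exact hA.cfc_congr_nonneg fun x hx => Real.mul_rpow hc hx

lemma PosSemidef.kappa_smul_inv_smul {A B : Matrix n n ℂ} (hA : A.PosSemidef)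
    (hB : B.PosSemidef) {c : ℝ} (hc : 0 < c) (p : ℝ) :
    kappa p (c • A) (c⁻¹ • B) = kappa p A B := by
  rw [kappa, kappa, hA.rpowCFC_smul hc.le, hB.rpowCFC_smul (inv_nonneg.2 hc.le)]
  simp only [smul_mul_assoc, mul_smul_comm, smul_smul]
  have : c ^ (p / 4) * (c⁻¹ ^ (p / 2) * c ^ (p / 4)) = 1 := by
    rw [Real.inv_rpow hc.le, ← Real.rpow_neg hc.le, ← Real.rpow_add hc, ← Real.rpow_add hc]
    ring_nf
    simp
  rw [this, one_smul]

lemma PosSemidef.trace_kappa_eq_ofReal {A B : Matrix n n ℂ} (hB : B.PosSemidef)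
    {p : ℝ} (hp : 0 < p) : (kappa p A B).trace = ((kappa p A B).trace.re : ℂ) := by
  rw [hB.kappa_eq hp, rpowCFC, (isHermitian_conjTranspose_mul_self _).trace_cfc, Complex.ofReal_re]

end Matrix

lemma le_sqrt_mul_of_forall_le {a b x : ℝ} (ha : 0 ≤ a) (hb : 0 ≤ b)
    (h : ∀ c, 0 < c → x ≤ (c * a + c⁻¹ * b) / 2) : x ≤ √(a * b) := by
  rcases ha.eq_or_lt with rfl | ha
  · rw [zero_mul, Real.sqrt_zero]
    by_contra! hx
    have := h ((b + 1) / x) (by positivity)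
    rw [inv_div, mul_zero, zero_add, div_mul_eq_mul_div, div_div,
      le_div_iff₀ (by positivity)] at this
    nlinarith
  rcases hb.eq_or_lt with rfl | hb
  · rw [mul_zero, Real.sqrt_zero]
    by_contra! hx
    have := h (x / a) (by positivity)
    rw [div_mul_cancel₀ _ ha.ne'] at this
    linarith
  · have := h (√b / √a) (by positivity)
    have e : (√b / √a * a + (√b / √a)⁻¹ * b) / 2 = √(a * b) := by
      rw [Real.sqrt_mul ha.le]
      have h1 := Real.mul_self_sqrt ha.le
      have h2 := Real.mul_self_sqrt hb.le
      have h3 := Real.sqrt_pos.2 ha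
      have h4 := Real.sqrt_pos.2 hb
      have e1 : √b / √a * a = √a * √b := by
        rw [div_mul_eq_mul_div, div_eq_iff h3.ne']; linear_combination (-√b) * h1
      have e2 : (√b / √a)⁻¹ * b = √a * √b := by
        rw [inv_div, div_mul_eq_mul_div, div_eq_iff h4.ne']; linear_combination (-√a) * h2
      rw [e1, e2, add_self_div_two]
    rwa [e] at this

/-- Trace arithmetic–κₚ inequality for matrices:
`Tr(A κₚ B) ≤ √(Tr A · Tr B) ≤ Tr((A + B)/2)`, and in particular
`Tr((A + B)/2 − A κₚ B) ≥ 0`, for all `p > 0`. -/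
theorem trace_kappa_le_sqrt_le_am {n : Type*} [Fintype n] [DecidableEq n]
    (p : ℝ) (hp : 0 < p) (A B : Matrix n n ℂ) (hA : A.PosSemidef) (hB : B.PosSemidef) :
    Matrix.trace (Matrix.kappa p A B) ≤
        (Real.sqrt ((Matrix.trace A).re * (Matrix.trace B).re) : ℂ) ∧
      (Real.sqrt ((Matrix.trace A).re * (Matrix.trace B).re) : ℂ) ≤
        Matrix.trace ((2 : ℂ)⁻¹ • (A + B)) ∧
      0 ≤ Matrix.trace ((2 : ℂ)⁻¹ • (A + B) - Matrix.kappa p A B) := by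
  obtain ⟨ha, ha'⟩ := Complex.le_def.1 hA.trace_nonneg
  obtain ⟨hb, hb'⟩ := Complex.le_def.1 hB.trace_nonneg
  rw [Complex.zero_re] at ha hb
  rw [Complex.zero_im] at ha' hb'
  have hAM : Matrix.trace ((2 : ℂ)⁻¹ • (A + B)) =
      (((Matrix.trace A).re + (Matrix.trace B).re) / 2 : ℝ) := by
    rw [Matrix.trace_smul, Matrix.trace_add]
    apply Complex.ext <;> simp [← ha', ← hb']
    ring
  have h1 : (Matrix.trace (Matrix.kappa p A B)).re ≤
      √((Matrix.trace A).re * (Matrix.trace B).re) := by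
    refine le_sqrt_mul_of_forall_le ha hb fun c hc => ?_
    have h := (hA.smul hc.le).re_trace_kappa_le (hB.smul (inv_nonneg.2 hc.le)) hp
    rw [hA.kappa_smul_inv_smul hB hc] at h
    simpa [Matrix.trace_smul] using h
  have h2 : √((Matrix.trace A).re * (Matrix.trace B).re) ≤
      ((Matrix.trace A).re + (Matrix.trace B).re) / 2 :=
    Real.sqrt_le_iff.2 ⟨by positivity, by
      nlinarith [sq_nonneg ((Matrix.trace A).re - (Matrix.trace B).re)]⟩
  rw [Matrix.trace_sub, hAM, hB.trace_kappa_eq_ofReal hp, sub_nonneg]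
  exact ⟨Complex.real_le_real.2 h1, Complex.real_le_real.2 h2,
    Complex.real_le_real.2 (h1.trans h2)⟩
end

section
/- Let 𝒜 be a unital C*-algebra and let τ : 𝒜 → ℂ be a faithful tracial positive linear functional. Then for every p > 0 and all positive elements A, B of 𝒜, one has τ((A + B)/2 − A κₚ B) ≥ 0 (where the value is in fact a nonnegative real number). -/
open scoped ComplexOrder

/-- A continuous midpoint-convex function on the real line is convex. -/
lemma convexOn_univ_of_continuous_of_midpoint {f : ℝ → ℝ} (hf : Continuous f)
    (hmid : ∀ x y, 2 * f ((x + y) / 2) ≤ f x + f y) : ConvexOn ℝ Set.univ f := by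
  refine ⟨convex_univ, fun a _ b _ u v hu hv huv => ?_⟩
  let g : ℝ → ℝ := fun s => f ((1 - s) * a + s * b) - ((1 - s) * f a + s * f b)
  have hg : Continuous g := by fun_prop
  have hg0 : g 0 = 0 := by simp [g]
  have hg1 : g 1 = 0 := by simp [g]
  have hgmid (x y : ℝ) : 2 * g ((x + y) / 2) ≤ g x + g y := by
    have h := hmid ((1 - x) * a + x * b) ((1 - y) * a + y * b)
    rw [show ((1 - x) * a + x * b + ((1 - y) * a + y * b)) / 2
      = (1 - (x + y) / 2) * a + (x + y) / 2 * b by ring] at h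
    simp only [g]
    linarith
  obtain ⟨c, hc, hcmax⟩ := isCompact_Icc.exists_isMaxOn
    (Set.nonempty_Icc.2 (zero_le_one (α := ℝ))) hg.continuousOn
  have hgle : g c ≤ 0 := by
    by_contra! hpos
    obtain ⟨d, ⟨hd, hdc⟩, hdmin⟩ := (isCompact_Icc.inter_right
      (isClosed_eq hg (continuous_const (y := g c)))).exists_isLeast ⟨c, hc, rfl⟩
    have hdc : g d = g c := hdc
    have hd0 : 0 < d := lt_of_le_of_ne hd.1 fun h => by rw [← h] at hdc; linarith
    have hd1 : d < 1 := lt_of_le_of_ne hd.2 fun h => by rw [h] at hdc; linarith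
    have hh : 0 < min d (1 - d) := lt_min hd0 (by linarith)
    have hl : min d (1 - d) ≤ d := min_le_left _ _
    have hr : min d (1 - d) ≤ 1 - d := min_le_right _ _
    generalize min d (1 - d) = h at hh hl hr
    have hmem1 : d - h ∈ Set.Icc (0 : ℝ) 1 := ⟨by linarith, by linarith⟩
    have hmem2 : d + h ∈ Set.Icc (0 : ℝ) 1 := ⟨by linarith, by linarith⟩
    have hle1 : g (d - h) ≤ g c := hcmax hmem1
    have hle2 : g (d + h) ≤ g c := hcmax hmem2
    have hlt : g (d - h) < g c := lt_of_le_of_ne hle1 fun h' => by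
      have := hdmin ⟨hmem1, h'⟩
      linarith
    have := hgmid (d - h) (d + h)
    rw [show (d - h + (d + h)) / 2 = d by ring] at this
    linarith
  have hgv : g v ≤ g c := hcmax ⟨hv, by linarith⟩
  have : u = 1 - v := by linarith
  subst this
  simp only [g] at hgv hgle
  simp only [smul_eq_mul]
  linarith

section TracialFunctional

variable {𝒜 : Type*} [CStarAlgebra 𝒜] [PartialOrder 𝒜] [StarOrderedRing 𝒜]

lemma CFC.rpow_eq_exp_smul_log {A : 𝒜} (hA : IsStrictlyPositive A) (s : ℝ) :
    A ^ s = NormedSpace.exp (s • CFC.log A) := by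
  have h0 : ∀ x ∈ spectrum ℝ A, x ≠ 0 := fun x hx h =>
    spectrum.zero_notMem ℝ hA.isUnit (h ▸ hx)
  have hlog : ContinuousOn Real.log (spectrum ℝ A) := fun x hx =>
    (Real.continuousAt_log (h0 x hx)).continuousWithinAt
  have hsa : IsSelfAdjoint A := .of_nonneg hA.nonneg
  rw [CFC.rpow_eq_cfc_real (ha := hA.nonneg), CFC.log, ← cfc_smul s Real.log A hlog,
    ← CFC.real_exp_eq_normedSpace_exp (cfc_predicate _ A),
    ← cfc_comp' Real.exp (fun x => s • Real.log x) A]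
  refine cfc_congr fun x hx => ?_
  have hx0 : 0 < x := lt_of_le_of_ne (spectrum_nonneg_of_nonneg hA.nonneg hx) (h0 x hx).symm
  simp [Real.rpow_def_of_pos hx0, mul_comm]

lemma CFC.continuous_rpow_exponent {A : 𝒜} (hA : IsStrictlyPositive A) :
    Continuous fun s : ℝ => A ^ s := by
  simp_rw [CFC.rpow_eq_exp_smul_log hA]
  have : Continuous (NormedSpace.exp : 𝒜 → 𝒜) := by
    let := NormedAlgebra.restrictScalars ℚ ℂ 𝒜
    exact NormedSpace.exp_continuous
  exact this.comp (by fun_prop)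

lemma CFC.isSelfAdjoint_rpow (A : 𝒜) (s : ℝ) : star (A ^ s) = A ^ s :=
  (IsSelfAdjoint.of_nonneg CFC.rpow_nonneg).star_eq

lemma CFC.continuousOn_rpow_of_nonneg {s : ℝ} (hs : 0 ≤ s) :
    ContinuousOn (fun A : 𝒜 => A ^ s) {A | 0 ≤ A} := by
  have hc : Continuous fun x : NNReal => x ^ s := NNReal.continuous_rpow_const hs
  exact ContinuousOn.cfc_nnreal_of_mem_nhdsSet (s := Set.univ) _ Filter.univ_mem
    continuousOn_id (fun _ h => h) hc.continuousOn

lemma convexOn_trace_rpow_mul_rpow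
    (t : 𝒜 →L[ℝ] ℝ) (hpos : ∀ X : 𝒜, 0 ≤ X → 0 ≤ t X)
    (hcomm : ∀ X Y : 𝒜, t (X * Y) = t (Y * X))
    {C D B : 𝒜} (hC : IsStrictlyPositive C)
    (hD : IsStrictlyPositive D) (hB : star B = B) (k : ℝ) :
    ConvexOn ℝ Set.univ fun s : ℝ => t (C ^ (k - s) * (B * D ^ s * B)) := by
  apply convexOn_univ_of_continuous_of_midpoint
  · have h1 := CFC.continuous_rpow_exponent hC
    have h2 := CFC.continuous_rpow_exponent hD
    have h3 : Continuous fun s : ℝ => C ^ (k - s) := h1.comp (continuous_const.sub continuous_id)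
    fun_prop
  · intro s r
    have key (u v x y : ℝ) : t (C ^ u * B * D ^ x * (D ^ y * B * C ^ v)) =
        t (C ^ (u + v) * (B * D ^ (x + y) * B)) := by
      rw [add_comm u v, CFC.rpow_add hC.isUnit, CFC.rpow_add hD.isUnit, mul_assoc (C ^ v),
        hcomm (C ^ v)]
      simp only [mul_assoc]
    have h := hpos _ (mul_star_self_nonneg (C ^ ((k - s) / 2) * B * D ^ (s / 2) -
      C ^ ((k - r) / 2) * B * D ^ (r / 2)))
    simp only [star_sub, star_mul, hB, CFC.isSelfAdjoint_rpow, sub_mul, mul_sub, map_sub] at h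
    simp only [← mul_assoc] at key h
    simp only [key] at h
    simp only [mul_assoc] at h ⊢
    rw [show (k - s) / 2 + (k - s) / 2 = k - s by ring, show s / 2 + s / 2 = s by ring,
      show (k - r) / 2 + (k - r) / 2 = k - r by ring, show r / 2 + r / 2 = r by ring,
      show (k - s) / 2 + (k - r) / 2 = k - (s + r) / 2 by ring,
      show (k - r) / 2 + (k - s) / 2 = k - (s + r) / 2 by ring,
      show s / 2 + r / 2 = (s + r) / 2 by ring, show r / 2 + s / 2 = (s + r) / 2 by ring] at h
    linarith

/-- Young's inequality for a tracial positive functional. -/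
lemma trace_rpow_mul_rpow_le
    (t : 𝒜 →L[ℝ] ℝ) (hpos : ∀ X : 𝒜, 0 ≤ X → 0 ≤ t X)
    (hcomm : ∀ X Y : 𝒜, t (X * Y) = t (Y * X))
    {A C : 𝒜} (hA : IsStrictlyPositive A) (hC : IsStrictlyPositive C)
    {y : ℝ} (hy0 : 0 ≤ y) (hy1 : y ≤ 1) :
    t (A ^ (1 - y) * C ^ y) ≤ (1 - y) * t A + y * t C := by
  have h := (convexOn_trace_rpow_mul_rpow t hpos hcomm hA hC (star_one 𝒜) 1).2
    (Set.mem_univ 0) (Set.mem_univ 1) (sub_nonneg.2 hy1) hy0 (by ring)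
  simpa [CFC.rpow_zero _ hA.nonneg, CFC.rpow_zero _ hC.nonneg, CFC.rpow_one _ hA.nonneg,
    CFC.rpow_one _ hC.nonneg] using h

lemma isStrictlyPositive_rpow_mul_rpow_mul_rpow {A C : 𝒜} (hA : IsStrictlyPositive A)
    (hC : IsStrictlyPositive C) (x y : ℝ) :
    IsStrictlyPositive (A ^ x * C ^ y * A ^ x) :=
  ⟨conjugate_nonneg_of_nonneg CFC.rpow_nonneg CFC.rpow_nonneg,
    ((hA.rpow _ x).isUnit.mul (hC.rpow _ y).isUnit).mul (hA.rpow _ x).isUnit⟩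

lemma mul_trace_rpow_inv_le_of_le_one
    (t : 𝒜 →L[ℝ] ℝ) (hpos : ∀ X : 𝒜, 0 ≤ X → 0 ≤ t X)
    (hcomm : ∀ X Y : 𝒜, t (X * Y) = t (Y * X))
    {A C : 𝒜} (hA : IsStrictlyPositive A)
    (hC : IsStrictlyPositive C) {x y : ℝ} (hx : 0 < x) (hy : 0 < y) (hp : x + y ≤ 1) :
    (x + y) * t ((A ^ (x / 2) * C ^ y * A ^ (x / 2)) ^ (x + y)⁻¹) ≤ x * t A + y * t C := by
  have hX := isStrictlyPositive_rpow_mul_rpow_mul_rpow hA hC (x / 2) y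
  set X := A ^ (x / 2) * C ^ y * A ^ (x / 2) with hXdef
  have hxy : 0 < x + y := by positivity
  have hx1 : 0 < 1 - x := by linarith
  have hD : IsStrictlyPositive (X ^ (x + y)⁻¹) := hX.rpow _ _
  set D := X ^ (x + y)⁻¹ with hDdef
  have hXD : X = D ^ (x + y) := (CFC.rpow_inv_rpow X (x + y) hxy.ne' hX).symm
  have hA2 : A ^ (x / 2) * A ^ (x / 2) = A ^ x := by
    rw [← CFC.rpow_add hA.isUnit, add_halves]
  -- `D = X * D ^ (1 - x - y)`, and the trace of the right side is estimated by convexity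
  have hDX : t D = t (C ^ (1 - x - (1 - x - y)) * (A ^ (x / 2) * D ^ (1 - x - y) * A ^ (x / 2))) := by
    have h1 : D = X * D ^ (1 - x - y) := by
      rw [hXD, ← CFC.rpow_add hD.isUnit, show x + y + (1 - x - y) = 1 by ring,
        CFC.rpow_one _ hD.nonneg]
    conv_lhs => rw [h1, hXdef]
    rw [show 1 - x - (1 - x - y) = y by ring, mul_assoc, mul_assoc, hcomm]
    simp only [mul_assoc]
  have hconv := (convexOn_trace_rpow_mul_rpow t hpos hcomm hC hD
    (CFC.isSelfAdjoint_rpow A (x / 2)) (1 - x)).2 (Set.mem_univ 0) (Set.mem_univ (1 - x))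
    (show 0 ≤ y / (1 - x) by positivity)
    (show 0 ≤ (1 - x - y) / (1 - x) from div_nonneg (by linarith) hx1.le) (by field_simp; ring)
  have e : (y / (1 - x)) • (0 : ℝ) + ((1 - x - y) / (1 - x)) • (1 - x) = 1 - x - y := by
    simp only [smul_eq_mul]; field_simp; ring
  simp only [e] at hconv
  rw [← hDX] at hconv
  have hYC := trace_rpow_mul_rpow_le t hpos hcomm hC hA hx.le (by linarith)
  have hYD := trace_rpow_mul_rpow_le t hpos hcomm hD hA hx.le (by linarith)
  simp only [sub_zero, sub_self, CFC.rpow_zero _ hD.nonneg, CFC.rpow_zero _ hC.nonneg, mul_one,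
    one_mul, hA2, smul_eq_mul] at hconv
  rw [mul_assoc (A ^ (x / 2)), hcomm (A ^ (x / 2)), mul_assoc, hA2] at hconv
  have hconv' : (1 - x) * t D ≤ y * t (C ^ (1 - x) * A ^ x) +
      (1 - x - y) * t (D ^ (1 - x) * A ^ x) := by
    calc (1 - x) * t D ≤ (1 - x) * _ := mul_le_mul_of_nonneg_left hconv hx1.le
      _ = _ := by field_simp
  have h1 := mul_le_mul_of_nonneg_left hYC hy.le
  have h2 := mul_le_mul_of_nonneg_left hYD (show 0 ≤ 1 - x - y by linarith)
  refine le_of_mul_le_mul_left (a := 1 - x) ?_ hx1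
  linarith

/-- Convexity between the exponents `0` and `p` for the pair `X ^ p⁻¹`, `L`. -/
lemma mul_trace_rpow_inv_le_add
    (t : 𝒜 →L[ℝ] ℝ) (hpos : ∀ X : 𝒜, 0 ≤ X → 0 ≤ t X)
    (hcomm : ∀ X Y : 𝒜, t (X * Y) = t (Y * X))
    {X L : 𝒜} (hX : IsStrictlyPositive X)
    (hL : IsStrictlyPositive L) {p : ℝ} (hp : 1 ≤ p) :
    p * t (X ^ p⁻¹) ≤ t (X * L ^ (1 - p)) + (p - 1) * t L := by
  have hp0 : 0 < p := by linarith
  have hN : IsStrictlyPositive (X ^ p⁻¹) := hX.rpow _ _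
  have hconv := (convexOn_trace_rpow_mul_rpow t hpos hcomm hL hN (star_one 𝒜) 1).2
    (Set.mem_univ 0) (Set.mem_univ p) (show 0 ≤ (p - 1) / p from div_nonneg (by linarith) hp0.le)
    (show 0 ≤ p⁻¹ by positivity) (by field_simp; ring)
  have e : ((p - 1) / p) • (0 : ℝ) + p⁻¹ • p = 1 := by
    simp only [smul_eq_mul]; field_simp; ring
  simp only [e] at hconv
  simp only [sub_zero, sub_self, CFC.rpow_zero _ hL.nonneg, CFC.rpow_zero _ hN.nonneg, mul_one,
    one_mul, smul_eq_mul, CFC.rpow_one _ hL.nonneg, CFC.rpow_one _ hN.nonneg,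
    CFC.rpow_inv_rpow X p hp0.ne' hX] at hconv
  rw [hcomm X]
  calc p * t (X ^ p⁻¹) ≤ p * _ := mul_le_mul_of_nonneg_left hconv hp0.le
    _ = _ := by field_simp; ring

lemma mul_trace_rpow_inv_le_of_one_le
    (t : 𝒜 →L[ℝ] ℝ) (hpos : ∀ X : 𝒜, 0 ≤ X → 0 ≤ t X)
    (hcomm : ∀ X Y : 𝒜, t (X * Y) = t (Y * X))
    {A C : 𝒜} (hA : IsStrictlyPositive A)
    (hC : IsStrictlyPositive C) {x y : ℝ} (hy : 0 ≤ y) (hy1 : y ≤ 1) (hp : 1 ≤ x + y) :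
    (x + y) * t ((A ^ (x / 2) * C ^ y * A ^ (x / 2)) ^ (x + y)⁻¹) ≤ x * t A + y * t C := by
  have h := mul_trace_rpow_inv_le_add t hpos hcomm
    (isStrictlyPositive_rpow_mul_rpow_mul_rpow hA hC (x / 2) y) hA hp
  have hY := trace_rpow_mul_rpow_le t hpos hcomm hA hC hy hy1
  have e : t (A ^ (x / 2) * C ^ y * A ^ (x / 2) * A ^ (1 - (x + y))) =
      t (A ^ (1 - y) * C ^ y) := by
    rw [mul_assoc, ← CFC.rpow_add hA.isUnit, mul_assoc, hcomm, mul_assoc,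
      ← CFC.rpow_add hA.isUnit, hcomm]
    ring_nf
  linarith

lemma mul_trace_rpow_inv_le_of_one_le_left
    (t : 𝒜 →L[ℝ] ℝ) (hpos : ∀ X : 𝒜, 0 ≤ X → 0 ≤ t X)
    (hcomm : ∀ X Y : 𝒜, t (X * Y) = t (Y * X))
    {A C : 𝒜} (hA : IsStrictlyPositive A)
    (hC : IsStrictlyPositive C) {x : ℝ} (hx : 1 ≤ x) (n : ℕ) {y : ℝ} (hy : 0 ≤ y)
    (hyn : y ≤ n + 1) :
    (x + y) * t ((A ^ (x / 2) * C ^ y * A ^ (x / 2)) ^ (x + y)⁻¹) ≤ x * t A + y * t C := by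
  induction n generalizing y with
  | zero =>
    exact mul_trace_rpow_inv_le_of_one_le t hpos hcomm hA hC hy (by simpa using hyn) (by linarith)
  | succ n ih =>
    rcases le_total y 1 with hy1 | hy1
    · exact mul_trace_rpow_inv_le_of_one_le t hpos hcomm hA hC hy hy1 (by linarith)
    have ih' := ih (y := y - 1) (by linarith) (by push_cast at hyn; linarith)
    have hY := isStrictlyPositive_rpow_mul_rpow_mul_rpow hA hC (x / 2) (y - 1)
    have h := mul_trace_rpow_inv_le_add t hpos hcomm
      (isStrictlyPositive_rpow_mul_rpow_mul_rpow hA hC (x / 2) y)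
      (hY.rpow _ (x + (y - 1))⁻¹) (show 1 ≤ x + y by linarith)
    set Y := A ^ (x / 2) * C ^ (y - 1) * A ^ (x / 2) with hYdef
    have hpow : (Y ^ (x + (y - 1))⁻¹) ^ (1 - (x + y)) = Y ^ (-1 : ℝ) := by
      have hne : x + (y - 1) ≠ 0 := by linarith
      rw [CFC.rpow_rpow _ _ _ (inv_ne_zero hne) hY]
      congr 1
      field_simp
      ring
    have hXY : A ^ (x / 2) * C ^ y * A ^ (x / 2) = A ^ (x / 2) * C * A ^ (-(x / 2)) * Y := by
      rw [hYdef, show C ^ y = C * C ^ (y - 1) by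
        conv_rhs => enter [1]; rw [← CFC.rpow_one C hC.nonneg]
        rw [← CFC.rpow_add hC.isUnit, add_sub_cancel]]
      simp only [mul_assoc]
      rw [← mul_assoc (A ^ (-(x / 2))), CFC.rpow_neg_mul_rpow _ hA, one_mul]
    have e : t (A ^ (x / 2) * C ^ y * A ^ (x / 2) * Y ^ (-1 : ℝ)) = t C := by
      have hinv : Y * Y ^ (-1 : ℝ) = 1 := by
        simpa [CFC.rpow_one _ hY.nonneg] using CFC.rpow_mul_rpow_neg 1 hY
      rw [hXY, mul_assoc, hinv, mul_one, hcomm, ← mul_assoc, CFC.rpow_neg_mul_rpow _ hA, one_mul]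
    rw [hpow, e] at h
    linarith

/-- The trace inequality for invertible positive elements. -/
lemma two_mul_trace_kappa_le
    (t : 𝒜 →L[ℝ] ℝ) (hpos : ∀ X : 𝒜, 0 ≤ X → 0 ≤ t X)
    (hcomm : ∀ X Y : 𝒜, t (X * Y) = t (Y * X))
    {A B : 𝒜} (hA : IsStrictlyPositive A)
    (hB : IsStrictlyPositive B) {p : ℝ} (hp : 0 < p) :
    2 * t ((A ^ (p / 4) * B ^ (p / 2) * A ^ (p / 4)) ^ p⁻¹) ≤ t A + t B := by
  have key : (p / 2 + p / 2) *
      t ((A ^ (p / 2 / 2) * B ^ (p / 2) * A ^ (p / 2 / 2)) ^ (p / 2 + p / 2)⁻¹) ≤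
      p / 2 * t A + p / 2 * t B := by
    rcases le_total p 1 with h1 | h1
    · exact mul_trace_rpow_inv_le_of_le_one t hpos hcomm hA hB (by positivity) (by positivity)
        (by linarith)
    rcases le_total p 2 with h2 | h2
    · exact mul_trace_rpow_inv_le_of_one_le t hpos hcomm hA hB (by positivity) (by linarith)
        (by linarith)
    · obtain ⟨n, hn⟩ := exists_nat_ge (p / 2)
      exact mul_trace_rpow_inv_le_of_one_le_left t hpos hcomm hA hB (by linarith) n
        (by positivity) (by linarith)
  rw [add_halves, show p / 2 / 2 = p / 4 by ring] at key
  refine le_of_mul_le_mul_left (a := p / 2) ?_ (by positivity)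
  linarith

end TracialFunctional

/-- In a unital C*-algebra with a faithful tracial positive linear functional `τ`,
`τ((A + B)/2 − A κₚ B) ≥ 0` (a nonnegative real number, in the complex order) for every
`p > 0` and all positive `A, B`, where `A κₚ B := (A^{p/4} B^{p/2} A^{p/4})^{1/p}` via the
continuous functional calculus on `[0, ∞)`. -/
theorem cstar_trace_am_sub_kappa_nonneg {𝒜 : Type*} [CStarAlgebra 𝒜]
    [PartialOrder 𝒜] [StarOrderedRing 𝒜]
    (τ : 𝒜 →ₗ[ℂ] ℂ)
    (τ_pos : ∀ X : 𝒜, 0 ≤ X → 0 ≤ τ X)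
    (τ_tracial : ∀ X Y : 𝒜, τ (X * Y) = τ (Y * X))
    (τ_faithful : ∀ X : 𝒜, τ (star X * X) = 0 → X = 0)
    (p : ℝ) (hp : 0 < p) (A B : 𝒜) (hA : 0 ≤ A) (hB : 0 ≤ B) :
    0 ≤ τ ((2 : ℂ)⁻¹ • (A + B) -
        (A ^ (p / 4 : ℝ) * B ^ (p / 2 : ℝ) * A ^ (p / 4 : ℝ)) ^ (p⁻¹ : ℝ)) := by
  let τ' : 𝒜 →ₚ[ℂ] ℂ := PositiveLinearMap.mk₀ τ τ_pos
  have hτ : Continuous τ := map_continuous τ'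
  let t : 𝒜 →L[ℝ] ℝ := Complex.reCLM.comp ⟨τ.restrictScalars ℝ, hτ⟩
  have ht (X : 𝒜) : t X = (τ X).re := rfl
  have hnonneg (X : 𝒜) (hX : 0 ≤ X) : 0 ≤ t X := (Complex.nonneg_iff.1 (τ_pos X hX)).1
  have hcomm (X Y : 𝒜) : t (X * Y) = t (Y * X) := by rw [ht, ht, τ_tracial]
  have him (X : 𝒜) (hX : 0 ≤ X) : (τ X).im = 0 := (Complex.nonneg_iff.1 (τ_pos X hX)).2.symm
  -- approximate `A` and `B` by the invertible elements `A + ε` and `B + ε`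
  have hε {E : 𝒜} (hE : 0 ≤ E) {ε : ℝ} (h : 0 < ε) : IsStrictlyPositive (E + ε • (1 : 𝒜)) :=
    .nonneg_add hE (isStrictlyPositive_one.smul h)
  have hεnonneg {E : 𝒜} (hE : 0 ≤ E) {ε : ℝ} (h : 0 ≤ ε) : 0 ≤ E + ε • (1 : 𝒜) :=
    add_nonneg hE (smul_nonneg h zero_le_one)
  have hcont (E : 𝒜) (hE : 0 ≤ E) (s : ℝ) (hs : 0 ≤ s) :
      ContinuousOn (fun ε : ℝ => (E + ε • (1 : 𝒜)) ^ s) (Set.Ici 0) :=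
    (CFC.continuousOn_rpow_of_nonneg hs).comp (by fun_prop) fun ε h => hεnonneg hE h
  have hκ : ContinuousOn (fun ε : ℝ => ((A + ε • (1 : 𝒜)) ^ (p / 4) *
      (B + ε • (1 : 𝒜)) ^ (p / 2) * (A + ε • (1 : 𝒜)) ^ (p / 4)) ^ p⁻¹) (Set.Ici 0) :=
    (CFC.continuousOn_rpow_of_nonneg (inv_nonneg.2 hp.le)).comp
      (((hcont A hA _ (by positivity)).mul (hcont B hB _ (by positivity))).mul
        (hcont A hA _ (by positivity)))
      fun ε _ => conjugate_nonneg_of_nonneg CFC.rpow_nonneg CFC.rpow_nonneg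
  have hdiff : ContinuousOn (fun ε : ℝ => t (A + ε • (1 : 𝒜)) + t (B + ε • (1 : 𝒜)) -
      2 * t (((A + ε • (1 : 𝒜)) ^ (p / 4) * (B + ε • (1 : 𝒜)) ^ (p / 2) *
        (A + ε • (1 : 𝒜)) ^ (p / 4)) ^ p⁻¹)) (Set.Ici 0) :=
    ContinuousOn.sub (by fun_prop)
      (continuousOn_const.mul (t.continuous.comp_continuousOn hκ))
  have hlim := (hdiff 0 Set.self_mem_Ici).mono_left
    (nhdsWithin_mono 0 Set.Ioi_subset_Ici_self)
  have hmain := ge_of_tendsto (b := 0) hlim <| by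
    filter_upwards [self_mem_nhdsWithin] with ε h
    exact sub_nonneg.2 (two_mul_trace_kappa_le t hnonneg hcomm (hε hA h) (hε hB h) hp)
  simp only [zero_smul, add_zero, ht] at hmain
  rw [Complex.nonneg_iff]
  have hi := him _ (CFC.rpow_nonneg
    (a := A ^ (p / 4) * B ^ (p / 2) * A ^ (p / 4)) (y := p⁻¹))
  have hre : ((2 : ℂ)⁻¹).re = 2⁻¹ := by norm_num
  have him2 : ((2 : ℂ)⁻¹).im = 0 := by norm_num
  simp only [map_sub, map_smul, map_add, smul_eq_mul, Complex.sub_re, Complex.sub_im,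
    Complex.mul_re, Complex.mul_im, Complex.add_re, Complex.add_im, him A hA, him B hB, hi,
    hre, him2]
  constructor
  · linarith
  · simp
end
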